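/- arXiv:1909.09345 — 2 statements merged into one kernel-verified Lean document; each statement's English description precedes it below -/
import Mathlib

section
/- Let p ≥ 1, let λ = (λ₁,…,λ_p) be nonincreasing nonnegative weights with λ₁ > 0, and let x ∈ ℝ^p be a vector with exactly k nonzero entries (1 ≤ k ≤ p) whose nonzero entries have pairwise distinct absolute values. Fix δ > 0 and suppose δ > M_λ. Then the optimally tuned asymptotic MSE satisfies lim_{σ_z → 0⁺} δ(σ*(σ_z)² − σ_z²)/σ_z² = δ·M_λ/(δ − M_λ). -/
open MeasureTheory ProbabilityTheory Filter

/-- Standard Gaussian measure `N(0, I_n)` on `ℝⁿ`. -/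
noncomputable def stdGaussian (n : ℕ) : Measure (Fin n → ℝ) :=
  Measure.pi fun _ => gaussianReal 0 1

/-- The nonincreasing rearrangement of the absolute values of the entries of `x`. -/
noncomputable def sortedAbs {n : ℕ} (x : Fin n → ℝ) : Fin n → ℝ :=
  fun i => |x ((Tuple.sort fun j => -|x j|) i)|

/-- The sorted-ℓ1 (SLOPE) norm `‖x‖_λ = ∑ λ_i |x|_(i)`. -/
noncomputable def slopeNorm {n : ℕ} (lam x : Fin n → ℝ) : ℝ :=
  ∑ i, lam i * sortedAbs x i

/-- The SLOPE proximal objective `½‖u − v‖₂² + γ‖v‖_λ`. -/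
noncomputable def slopeObj {n : ℕ} (lam : Fin n → ℝ) (γ : ℝ) (u v : Fin n → ℝ) : ℝ :=
  (1/2) * ∑ i, (u i - v i)^2 + γ * slopeNorm lam v

/-- `v` is a minimizer of the SLOPE proximal objective, i.e. `v = η(u; γ, λ)`
(the minimizer is unique since the objective is strictly convex). -/
def IsSlopeProx {n : ℕ} (lam : Fin n → ℝ) (γ : ℝ) (u v : Fin n → ℝ) : Prop :=
  ∀ w, slopeObj lam γ u v ≤ slopeObj lam γ u w

/-! ### The sorted-ℓ1 norm -/

lemma sum_perm_le_of_antitone {n : ℕ} {lam x : Fin n → ℝ} (hlam : Antitone lam)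
    {π : Equiv.Perm (Fin n)} (hπ : Antitone fun i => |x (π i)|) (τ : Equiv.Perm (Fin n)) :
    ∑ i, lam i * |x (τ i)| ≤ ∑ i, lam i * |x (π i)| := by
  simpa using (hlam.monovary hπ).sum_mul_comp_perm_le_sum_mul (σ := π⁻¹ * τ)

lemma antitone_abs_sort {n : ℕ} (x : Fin n → ℝ) :
    Antitone fun i => |x (Tuple.sort (fun j => -|x j|) i)| :=
  fun _ _ h => neg_le_neg_iff.1 (Tuple.monotone_sort (fun j => -|x j|) h)

lemma sum_perm_le_slopeNorm {n : ℕ} {lam : Fin n → ℝ} (hlam : Antitone lam) (x : Fin n → ℝ)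
    (τ : Equiv.Perm (Fin n)) : ∑ i, lam i * |x (τ i)| ≤ slopeNorm lam x :=
  sum_perm_le_of_antitone hlam (antitone_abs_sort x) τ

lemma slopeNorm_eq_of_antitone {n : ℕ} {lam x : Fin n → ℝ} (hlam : Antitone lam)
    {π : Equiv.Perm (Fin n)} (hπ : Antitone fun i => |x (π i)|) :
    slopeNorm lam x = ∑ i, lam i * |x (π i)| :=
  le_antisymm (sum_perm_le_of_antitone hlam hπ _) (sum_perm_le_slopeNorm hlam x π)

lemma slopeNorm_smul {n : ℕ} {lam : Fin n → ℝ} (hlam : Antitone lam) {c : ℝ} (hc : 0 ≤ c)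
    (x : Fin n → ℝ) : slopeNorm lam (c • x) = c * slopeNorm lam x := by
  have h := antitone_abs_sort x
  rw [slopeNorm_eq_of_antitone hlam h, Finset.mul_sum, slopeNorm_eq_of_antitone hlam
    (x := c • x) (π := Tuple.sort (fun j => -|x j|))]
  · refine Finset.sum_congr rfl fun i _ => ?_
    simp only [Pi.smul_apply, smul_eq_mul, abs_mul, abs_of_nonneg hc]
    ring
  · intro i j hij
    simp only [Pi.smul_apply, smul_eq_mul, abs_mul]
    exact mul_le_mul_of_nonneg_left (h hij) (abs_nonneg c)

lemma slopeNorm_add_le {n : ℕ} {lam : Fin n → ℝ} (hlam : Antitone lam) (hnn : ∀ i, 0 ≤ lam i)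
    (x y : Fin n → ℝ) : slopeNorm lam (x + y) ≤ slopeNorm lam x + slopeNorm lam y := by
  set π := Tuple.sort (fun j => -|(x + y) j|)
  calc slopeNorm lam (x + y) = ∑ i, lam i * |(x + y) (π i)| := rfl
    _ ≤ ∑ i, (lam i * |x (π i)| + lam i * |y (π i)|) := by
        refine Finset.sum_le_sum fun i _ => ?_
        rw [← mul_add]
        exact mul_le_mul_of_nonneg_left (abs_add_le _ _) (hnn i)
    _ ≤ _ := by
        rw [Finset.sum_add_distrib]
        exact add_le_add (sum_perm_le_slopeNorm hlam x π) (sum_perm_le_slopeNorm hlam y π)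

lemma slopeNorm_neg {n : ℕ} (lam x : Fin n → ℝ) : slopeNorm lam (-x) = slopeNorm lam x := by
  simp [slopeNorm, sortedAbs]

lemma slopeNorm_le_mul_sum_abs {n : ℕ} {lam : Fin n → ℝ} (hnn : ∀ i, 0 ≤ lam i)
    (x : Fin n → ℝ) : slopeNorm lam x ≤ (∑ i, lam i) * ∑ j, |x j| := by
  rw [Finset.sum_mul]
  refine Finset.sum_le_sum fun i _ => mul_le_mul_of_nonneg_left ?_ (hnn i)
  exact Finset.single_le_sum (f := fun j => |x j|) (fun j _ => abs_nonneg _) (Finset.mem_univ _)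

lemma mul_abs_le_slopeNorm {n : ℕ} {lam : Fin n → ℝ} (hlam : Antitone lam)
    (hnn : ∀ i, 0 ≤ lam i) (x : Fin n → ℝ) (i j : Fin n) : lam i * |x j| ≤ slopeNorm lam x := by
  refine le_trans ?_ (sum_perm_le_slopeNorm hlam x (Equiv.swap i j))
  simpa using Finset.single_le_sum (f := fun l => lam l * |x (Equiv.swap i j l)|)
    (fun l _ => mul_nonneg (hnn l) (abs_nonneg _)) (Finset.mem_univ i)

/-! ### Optimality conditions for the proximal operator -/

/-- First-order optimality conditions: `(u - v) / γ` is a subgradient of the norm at `v`. -/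
def SlopeOptimal {n : ℕ} (lam : Fin n → ℝ) (γ : ℝ) (u v : Fin n → ℝ) : Prop :=
  (∀ w, (u - v) ⬝ᵥ w ≤ γ * slopeNorm lam w) ∧ (u - v) ⬝ᵥ v = γ * slopeNorm lam v

lemma slopeObj_eq {n : ℕ} (lam : Fin n → ℝ) (γ : ℝ) (u v : Fin n → ℝ) :
    slopeObj lam γ u v = (1/2) * ((u - v) ⬝ᵥ (u - v)) + γ * slopeNorm lam v := by
  simp [slopeObj, dotProduct, pow_two]

lemma dotProduct_self_nonneg' {n : ℕ} (v : Fin n → ℝ) : 0 ≤ v ⬝ᵥ v :=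
  Finset.sum_nonneg fun _ _ => mul_self_nonneg _

lemma nonneg_of_forall_smul_add_sq {a b : ℝ} (h : ∀ s, 0 < s → s < 1 → 0 ≤ s * a + s ^ 2 * b) :
    0 ≤ a := by
  by_contra! ha
  have hb : 0 < |b| + 1 - a := by linarith [abs_nonneg b]
  have hs : 0 < -a / (|b| + 1 - a) := div_pos (by linarith) hb
  have hs1 : -a / (|b| + 1 - a) < 1 := by
    rw [div_lt_one hb]; linarith [abs_nonneg b]
  have := h _ hs hs1
  set s := -a / (|b| + 1 - a) with hsd
  have h1 : s * (|b| + 1 - a) = -a := by rw [hsd]; field_simp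
  have h2 : 0 ≤ a + s * b := by
    by_contra! h'
    nlinarith
  nlinarith [le_abs_self b]

lemma IsSlopeProx.optimal {n : ℕ} {lam : Fin n → ℝ} (hlam : Antitone lam)
    (hnn : ∀ i, 0 ≤ lam i) {γ : ℝ} (hγ : 0 ≤ γ) {u v : Fin n → ℝ}
    (h : IsSlopeProx lam γ u v) : SlopeOptimal lam γ u v := by
  have key : ∀ w, (u - v) ⬝ᵥ w ≤ γ * slopeNorm lam w := by
    intro w
    suffices 0 ≤ γ * slopeNorm lam w - (u - v) ⬝ᵥ w by linarith
    refine nonneg_of_forall_smul_add_sq (b := (1/2) * (w ⬝ᵥ w)) fun s hs _ => ?_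
    have h1 := h (v + s • w)
    have h2 : slopeNorm lam (v + s • w) ≤ slopeNorm lam v + s * slopeNorm lam w :=
      (slopeNorm_add_le hlam hnn _ _).trans_eq (by rw [slopeNorm_smul hlam hs.le])
    have h3 := mul_le_mul_of_nonneg_left h2 hγ
    rw [slopeObj_eq, slopeObj_eq, show u - (v + s • w) = (u - v) - s • w by abel] at h1
    simp only [sub_dotProduct, dotProduct_sub, smul_dotProduct, dotProduct_smul, smul_eq_mul,
      dotProduct_comm w] at h1 ⊢
    nlinarith
  refine ⟨key, le_antisymm (key v) ?_⟩
  suffices 0 ≤ (u - v) ⬝ᵥ v - γ * slopeNorm lam v by linarith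
  refine nonneg_of_forall_smul_add_sq (b := (1/2) * (v ⬝ᵥ v)) fun s hs hs1 => ?_
  have h1 := h ((1 - s) • v)
  have h2 := slopeNorm_smul hlam (sub_nonneg.2 hs1.le) v
  rw [slopeObj_eq, slopeObj_eq, h2, show u - (1 - s) • v = (u - v) + s • v by module] at h1
  simp only [sub_dotProduct, dotProduct_sub, add_dotProduct, dotProduct_add, smul_dotProduct,
    dotProduct_smul, smul_eq_mul, dotProduct_comm v] at h1 ⊢
  nlinarith

namespace SlopeOptimal

variable {n : ℕ} {lam : Fin n → ℝ}

lemma smul (hlam : Antitone lam) {γ c : ℝ} (hc : 0 ≤ c) {u v : Fin n → ℝ}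
    (h : SlopeOptimal lam γ u v) : SlopeOptimal lam (c * γ) (c • u) (c • v) := by
  refine ⟨fun w => ?_, ?_⟩
  · rw [← smul_sub, smul_dotProduct, smul_eq_mul, mul_assoc]
    exact mul_le_mul_of_nonneg_left (h.1 w) hc
  · rw [← smul_sub, smul_dotProduct, dotProduct_smul, h.2, slopeNorm_smul hlam hc]
    simp only [smul_eq_mul]
    ring

lemma dotProduct_sub_self_le {γ γ' : ℝ} {u u' v v' : Fin n → ℝ} (h : SlopeOptimal lam γ u v)
    (h' : SlopeOptimal lam γ' u' v') :
    (v - v') ⬝ᵥ (v - v') ≤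
      (u - u') ⬝ᵥ (v - v') + (γ - γ') * (slopeNorm lam v' - slopeNorm lam v) := by
  have h1 := h.1 v'
  have h2 := h.2
  have h3 := h'.1 v
  have h4 := h'.2
  simp only [sub_dotProduct, dotProduct_sub] at *
  linarith

lemma nonexpansive {γ : ℝ} {u u' v v' : Fin n → ℝ} (h : SlopeOptimal lam γ u v)
    (h' : SlopeOptimal lam γ u' v') :
    (v - v') ⬝ᵥ (v - v') ≤ (u - u') ⬝ᵥ (u - u') := by
  have h1 := h.dotProduct_sub_self_le h'
  have h2 := dotProduct_self_nonneg' ((u - u') - (v - v'))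
  rw [sub_dotProduct, dotProduct_sub _ (u - u') (v - v'), dotProduct_sub _ (u - u') (v - v'),
    dotProduct_comm (v - v') (u - u')] at h2
  linarith

lemma unique {γ : ℝ} {u v v' : Fin n → ℝ} (h : SlopeOptimal lam γ u v)
    (h' : SlopeOptimal lam γ u v') : v = v' := by
  have := h.nonexpansive h'
  rw [sub_self, zero_dotProduct] at this
  exact sub_eq_zero.1
    (dotProduct_self_eq_zero.1 (le_antisymm this (dotProduct_self_nonneg' _)))

lemma self_le_of_le_mul_sum_abs {c : ℝ} {D : Fin n → ℝ} (h : D ⬝ᵥ D ≤ c * ∑ j, |D j|) :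
    D ⬝ᵥ D ≤ n * c ^ 2 := by
  have h1 : c * ∑ j, |D j| ≤ ∑ j, (1/2 * (D j * D j) + 1/2 * c ^ 2) := by
    rw [Finset.mul_sum]
    refine Finset.sum_le_sum fun j _ => ?_
    nlinarith [sq_nonneg (c - |D j|), abs_mul_abs_self (D j)]
  rw [Finset.sum_add_distrib, ← Finset.mul_sum] at h1
  simp only [Finset.sum_const, Finset.card_univ, Fintype.card_fin, nsmul_eq_mul] at h1
  change _ ≤ 1/2 * (D ⬝ᵥ D) + _ at h1
  linarith

lemma residual_le (hnn : ∀ i, 0 ≤ lam i) {γ : ℝ} (hγ : 0 ≤ γ) {u v : Fin n → ℝ}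
    (h : SlopeOptimal lam γ u v) : (u - v) ⬝ᵥ (u - v) ≤ n * (γ * ∑ i, lam i) ^ 2 := by
  refine self_le_of_le_mul_sum_abs ((h.1 _).trans ?_)
  rw [mul_assoc]
  exact mul_le_mul_of_nonneg_left (slopeNorm_le_mul_sum_abs hnn _) hγ

lemma parameter_lipschitz (hlam : Antitone lam) (hnn : ∀ i, 0 ≤ lam i) {γ γ' : ℝ}
    {u v v' : Fin n → ℝ} (h : SlopeOptimal lam γ u v) (h' : SlopeOptimal lam γ' u v') :
    (v - v') ⬝ᵥ (v - v') ≤ n * (|γ - γ'| * ∑ i, lam i) ^ 2 := by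
  refine self_le_of_le_mul_sum_abs ((h.dotProduct_sub_self_le h').trans ?_)
  rw [sub_self, zero_dotProduct, zero_add, mul_assoc]
  refine le_trans ?_ (mul_le_mul_of_nonneg_left (slopeNorm_le_mul_sum_abs hnn _) (abs_nonneg _))
  refine (le_abs_self _).trans ?_
  rw [abs_mul]
  refine mul_le_mul_of_nonneg_left ?_ (abs_nonneg _)
  have h1 := slopeNorm_add_le hlam hnn (v - v') v'
  have h2 := slopeNorm_add_le hlam hnn (-(v - v')) v
  rw [slopeNorm_neg] at h2
  rw [sub_add_cancel] at h1
  rw [show -(v - v') + v = v' by abel] at h2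
  exact abs_le.2 ⟨by linarith, by linarith⟩

/-- The error `‖η(t x + h) - t x‖` is nondecreasing in `t ≥ 0`. -/
lemma error_mono {γ s t : ℝ} (hs : 0 ≤ s) (hst : s ≤ t) {x h v w : Fin n → ℝ}
    (hv : SlopeOptimal lam γ (s • x + h) v) (hw : SlopeOptimal lam γ (t • x + h) w) :
    (v - s • x) ⬝ᵥ (v - s • x) ≤ (w - t • x) ⬝ᵥ (w - t • x) := by
  have h1 := hv.1 w
  have h2 := hv.2
  have h3 := hw.1 v
  have h4 := hw.2
  obtain ⟨A, rfl⟩ : ∃ A, w = A + t • x := ⟨w - t • x, by simp⟩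
  obtain ⟨B, rfl⟩ : ∃ B, v = B + s • x := ⟨v - s • x, by simp⟩
  rw [← h4, show t • x + h - (A + t • x) = h - A by abel,
    show s • x + h - (B + s • x) = h - B by abel] at h1
  rw [← h2, show t • x + h - (A + t • x) = h - A by abel,
    show s • x + h - (B + s • x) = h - B by abel] at h3
  simp only [add_sub_cancel_right]
  rcases hst.eq_or_lt with rfl | hlt
  · have := add_right_cancel (hv.unique hw)
    rw [this]
  have hAB := dotProduct_self_nonneg' (A - B)
  simp only [sub_dotProduct, dotProduct_sub, dotProduct_add, dotProduct_smul, smul_eq_mul,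
    dotProduct_comm B A] at *
  have h5 : B ⬝ᵥ B ≤ A ⬝ᵥ B := by
    by_contra! hcon
    nlinarith [mul_nonneg hs hAB, mul_le_mul_of_nonneg_left h1 hs,
      mul_le_mul_of_nonneg_left h3 (hs.trans hst), mul_pos (sub_pos.2 hlt) (sub_pos.2 hcon)]
  linarith

end SlopeOptimal

/-! ### Block structure of the norm at a vector with a well-separated support -/

/-- The permutation of `Fin (k + q)` that fixes the first `k` indices and acts by `τ` on the
last `q` ones. -/
def tailPerm (k : ℕ) {q : ℕ} (τ : Equiv.Perm (Fin q)) : Equiv.Perm (Fin (k + q)) :=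
  finSumFinEquiv.permCongr (Equiv.sumCongr (Equiv.refl _) τ)

@[simp]
lemma tailPerm_castAdd (k : ℕ) {q : ℕ} (τ : Equiv.Perm (Fin q)) (i : Fin k) :
    tailPerm k τ (Fin.castAdd q i) = Fin.castAdd q i := by
  simp [tailPerm, Equiv.permCongr_apply]

@[simp]
lemma tailPerm_natAdd (k : ℕ) {q : ℕ} (τ : Equiv.Perm (Fin q)) (j : Fin q) :
    tailPerm k τ (Fin.natAdd k j) = Fin.natAdd k (τ j) := by
  simp [tailPerm, Equiv.permCongr_apply]

section Block

variable {k q : ℕ} {lam : Fin (k + q) → ℝ} {lamq : Fin q → ℝ}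

lemma block_le_slopeNorm (hlam : Antitone lam) (hq : ∀ j, lamq j = lam (Fin.natAdd k j))
    (π : Equiv.Perm (Fin (k + q))) (w : Fin (k + q) → ℝ) :
    ∑ i : Fin k, lam (Fin.castAdd q i) * |w (π (Fin.castAdd q i))| +
      slopeNorm lamq (fun j => w (π (Fin.natAdd k j))) ≤ slopeNorm lam w := by
  refine le_trans (le_of_eq ?_) (sum_perm_le_slopeNorm hlam w
    (π * tailPerm k (Tuple.sort fun j => -|w (π (Fin.natAdd k j))|)))
  simp [Fin.sum_univ_add, slopeNorm, sortedAbs, hq]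

lemma slopeNorm_eq_block (hlam : Antitone lam) (hq : ∀ j, lamq j = lam (Fin.natAdd k j))
    (π : Equiv.Perm (Fin (k + q))) (w : Fin (k + q) → ℝ)
    (hanti : ∀ i j : Fin k, i ≤ j → |w (π (Fin.castAdd q j))| ≤ |w (π (Fin.castAdd q i))|)
    (hsep : ∀ (i : Fin k) (j : Fin q), |w (π (Fin.natAdd k j))| ≤ |w (π (Fin.castAdd q i))|) :
    slopeNorm lam w = ∑ i : Fin k, lam (Fin.castAdd q i) * |w (π (Fin.castAdd q i))| +
      slopeNorm lamq (fun j => w (π (Fin.natAdd k j))) := by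
  rw [slopeNorm_eq_of_antitone hlam
    (π := π * tailPerm k (Tuple.sort fun j => -|w (π (Fin.natAdd k j))|))]
  · simp [Fin.sum_univ_add, slopeNorm, sortedAbs, hq]
  · intro a b
    refine Fin.addCases (fun i => ?_) (fun i => ?_) a <;>
      refine Fin.addCases (fun j => ?_) (fun j => ?_) b <;> intro hab <;>
      simp only [Equiv.Perm.mul_apply, tailPerm_castAdd, tailPerm_natAdd]
    · exact hanti i j hab
    · exact hsep i _
    · have := Fin.le_def.1 hab
      simp only [Fin.val_natAdd, Fin.val_castAdd] at this
      omega
    · refine antitone_abs_sort (fun j => w (π (Fin.natAdd k j))) ?_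
      have := Fin.le_def.1 hab
      simp only [Fin.val_natAdd] at this
      exact Fin.le_def.2 (by omega)

lemma sum_eq_block (π : Equiv.Perm (Fin (k + q))) (f : Fin (k + q) → ℝ) :
    ∑ i, f i = ∑ i : Fin k, f (π (Fin.castAdd q i)) + ∑ j : Fin q, f (π (Fin.natAdd k j)) := by
  rw [← Equiv.sum_comp π, Fin.sum_univ_add]

/-- For large `t` the proximal point of `t x + h` splits into an explicit shift on the support
of `x` and the lower-dimensional proximal point off the support. -/
lemma eventually_slopeOptimal (hlam : Antitone lam) (hnn : ∀ i, 0 ≤ lam i)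
    (hq : ∀ j, lamq j = lam (Fin.natAdd k j)) (π : Equiv.Perm (Fin (k + q)))
    {x : Fin (k + q) → ℝ} {s : Fin k → ℝ} (hs : ∀ i, |s i| = 1)
    (hsx : ∀ i, s i * x (π (Fin.castAdd q i)) = |x (π (Fin.castAdd q i))|)
    (hx : ∀ i, 0 < |x (π (Fin.castAdd q i))|) (hx0 : ∀ j, x (π (Fin.natAdd k j)) = 0)
    (hanti : ∀ i j : Fin k, i < j → |x (π (Fin.castAdd q j))| < |x (π (Fin.castAdd q i))|)
    {χ : ℝ} (hχ : 0 ≤ χ) (h : Fin (k + q) → ℝ) {b : Fin q → ℝ}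
    (hb : SlopeOptimal lamq χ (fun j => h (π (Fin.natAdd k j))) b) :
    ∀ᶠ t : ℝ in atTop, SlopeOptimal lam χ (t • x + h) (fun l => Fin.addCases
      (fun i => t * x (π (Fin.castAdd q i)) + h (π (Fin.castAdd q i))
        - χ * (s i * lam (Fin.castAdd q i))) b (π.symm l)) := by
  have hss : ∀ i, s i * s i = 1 := fun i => by rw [← abs_mul_abs_self, hs, one_mul]
  have grow : ∀ a c d : ℝ, 0 < a → ∀ᶠ t : ℝ in atTop, d ≤ t * a + c := fun a c d ha =>
    (tendsto_atTop_add_const_right _ c (tendsto_id.atTop_mul_const ha)).eventually_ge_atTop d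
  set c : Fin k → ℝ := fun i => s i * h (π (Fin.castAdd q i)) - χ * lam (Fin.castAdd q i)
  have e1 : ∀ᶠ t : ℝ in atTop, ∀ i, 0 ≤ t * |x (π (Fin.castAdd q i))| + c i :=
    eventually_all.2 fun i => grow _ _ _ (hx i)
  have e2 : ∀ᶠ t : ℝ in atTop, ∀ i j, |b j| ≤ t * |x (π (Fin.castAdd q i))| + c i :=
    eventually_all.2 fun i => eventually_all.2 fun j => grow _ _ _ (hx i)
  have e3 : ∀ᶠ t : ℝ in atTop, ∀ i j, i < j → c j - c i ≤
      t * (|x (π (Fin.castAdd q i))| - |x (π (Fin.castAdd q j))|) + 0 :=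
    eventually_all.2 fun i => eventually_all.2 fun j => by
      by_cases hij : i < j
      · filter_upwards [grow _ 0 (c j - c i) (sub_pos.2 (hanti i j hij))] with t ht _ using ht
      · exact Eventually.of_forall fun _ h => absurd h hij
  filter_upwards [e1, e2, e3] with t h1 h2 h3
  set v : Fin (k + q) → ℝ := fun l => Fin.addCases
      (fun i => t * x (π (Fin.castAdd q i)) + h (π (Fin.castAdd q i))
        - χ * (s i * lam (Fin.castAdd q i))) b (π.symm l) with hvdef
  have hvc : ∀ i, v (π (Fin.castAdd q i)) = t * x (π (Fin.castAdd q i)) + h (π (Fin.castAdd q i))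
        - χ * (s i * lam (Fin.castAdd q i)) := fun i => by simp [hvdef]
  have hvn : ∀ j, v (π (Fin.natAdd k j)) = b j := fun j => by simp [hvdef]
  have hsv : ∀ i, s i * v (π (Fin.castAdd q i)) = t * |x (π (Fin.castAdd q i))| + c i := fun i => by
    rw [hvc, ← hsx]
    linear_combination (-χ * lam (Fin.castAdd q i)) * hss i
  have hav : ∀ i, |v (π (Fin.castAdd q i))| = s i * v (π (Fin.castAdd q i)) := fun i => by
    rw [← one_mul |v _|, ← hs i, ← abs_mul, abs_of_nonneg]
    rw [hsv]; exact h1 i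
  have hdot : ∀ w, (t • x + h - v) ⬝ᵥ w =
      χ * ∑ i, s i * lam (Fin.castAdd q i) * w (π (Fin.castAdd q i)) +
        ((fun j => h (π (Fin.natAdd k j))) - b) ⬝ᵥ fun j => w (π (Fin.natAdd k j)) := fun w => by
    rw [dotProduct, sum_eq_block π, Finset.mul_sum]
    congr 1
    · refine Finset.sum_congr rfl fun i _ => ?_
      simp only [Pi.sub_apply, Pi.add_apply, Pi.smul_apply, smul_eq_mul, hvc]
      ring
    · refine Finset.sum_congr rfl fun j _ => ?_
      simp [hvn, hx0]
  refine ⟨fun w => ?_, ?_⟩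
  · rw [hdot]
    refine le_trans (add_le_add ?_ (hb.1 _)) (le_trans (le_of_eq (mul_add _ _ _).symm)
      (mul_le_mul_of_nonneg_left (block_le_slopeNorm hlam hq π w) hχ))
    refine mul_le_mul_of_nonneg_left (Finset.sum_le_sum fun i _ => ?_) hχ
    rw [mul_comm (s i), mul_assoc]
    refine mul_le_mul_of_nonneg_left ((le_abs_self _).trans_eq ?_) (hnn _)
    rw [abs_mul, hs, one_mul]
  · have hvb : (fun j => v (π (Fin.natAdd k j))) = b := funext hvn
    rw [hdot, slopeNorm_eq_block hlam hq π v, hvb, hb.2, mul_add]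
    · congr 2
      refine Finset.sum_congr rfl fun i _ => ?_
      rw [hav]; ring
    · intro i j hij
      rcases hij.eq_or_lt with rfl | hlt
      · exact le_rfl
      · rw [hav, hav, hsv, hsv]
        linarith [h3 i j hlt]
    · intro i j
      rw [hav, hsv, hvn]
      exact h2 i j

lemma eventually_error_eq (hlam : Antitone lam) (hnn : ∀ i, 0 ≤ lam i)
    (hq : ∀ j, lamq j = lam (Fin.natAdd k j)) (π : Equiv.Perm (Fin (k + q)))
    {x : Fin (k + q) → ℝ} {s : Fin k → ℝ} (hs : ∀ i, |s i| = 1)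
    (hsx : ∀ i, s i * x (π (Fin.castAdd q i)) = |x (π (Fin.castAdd q i))|)
    (hx : ∀ i, 0 < |x (π (Fin.castAdd q i))|) (hx0 : ∀ j, x (π (Fin.natAdd k j)) = 0)
    (hanti : ∀ i j : Fin k, i < j → |x (π (Fin.castAdd q j))| < |x (π (Fin.castAdd q i))|)
    {χ : ℝ} (hχ : 0 ≤ χ) (h : Fin (k + q) → ℝ) {b : Fin q → ℝ}
    (hb : SlopeOptimal lamq χ (fun j => h (π (Fin.natAdd k j))) b)
    {v : ℝ → Fin (k + q) → ℝ} (hv : ∀ t, SlopeOptimal lam χ (t • x + h) (v t)) :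
    ∀ᶠ t : ℝ in atTop, ∑ l, (v t l - t * x l) ^ 2 =
      ∑ i, (h (π (Fin.castAdd q i)) - χ * (s i * lam (Fin.castAdd q i))) ^ 2 + ∑ j, b j ^ 2 := by
  filter_upwards [eventually_slopeOptimal hlam hnn hq π hs hsx hx hx0 hanti hχ h hb] with t ht
  rw [(hv t).unique ht, sum_eq_block π]
  congr 1
  · refine Finset.sum_congr rfl fun i _ => ?_
    simp only [Equiv.symm_apply_apply, Fin.addCases_left]
    ring
  · refine Finset.sum_congr rfl fun j _ => ?_
    simp [hx0]

end Block

/-! ### Continuity and integrability of the error -/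

lemma tendsto_of_sq_sub_le {X : Type*} {l : Filter X} {F g : X → ℝ} {a : ℝ}
    (h : ∀ᶠ y in l, (F y - a) ^ 2 ≤ g y) (hg : Tendsto g l (nhds 0)) :
    Tendsto F l (nhds a) := by
  rw [tendsto_iff_norm_sub_tendsto_zero]
  have h0 : Tendsto (fun y => √(g y)) l (nhds 0) := by
    simpa using hg.sqrt
  refine squeeze_zero' (Eventually.of_forall fun _ => norm_nonneg _) ?_ h0
  filter_upwards [h] with y hy
  rw [Real.norm_eq_abs]
  exact Real.abs_le_sqrt hy

lemma sq_apply_le_dotProduct_self {n : ℕ} (v : Fin n → ℝ) (i : Fin n) : v i ^ 2 ≤ v ⬝ᵥ v := by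
  rw [pow_two]
  exact Finset.single_le_sum (f := fun j => v j * v j) (fun j _ => mul_self_nonneg _)
    (Finset.mem_univ i)

section Error

variable {n : ℕ} {lam : Fin n → ℝ} {η : ℝ → (Fin n → ℝ) → (Fin n → ℝ)}

/-- The squared error of a denoiser `η` at signal strength `t` and noise `h`. -/
def sqError (η : ℝ → (Fin n → ℝ) → (Fin n → ℝ)) (x : Fin n → ℝ) (χ t : ℝ) (h : Fin n → ℝ) : ℝ :=
  ∑ i, (η χ (t • x + h) i - t * x i) ^ 2

/-- The mean squared error of `η` under standard Gaussian noise. -/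
noncomputable def meanSqError (η : ℝ → (Fin n → ℝ) → (Fin n → ℝ)) (x : Fin n → ℝ) (χ t : ℝ) : ℝ :=
  ∫ h, sqError η x χ t h ∂ stdGaussian n

lemma sqError_eq_dotProduct (x : Fin n → ℝ) (χ t : ℝ) (h : Fin n → ℝ) :
    sqError η x χ t h = (η χ (t • x + h) - t • x) ⬝ᵥ (η χ (t • x + h) - t • x) := by
  simp [sqError, dotProduct, pow_two]

lemma sqError_nonneg (x : Fin n → ℝ) (χ t : ℝ) (h : Fin n → ℝ) : 0 ≤ sqError η x χ t h :=
  Finset.sum_nonneg fun _ _ => sq_nonneg _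

lemma continuous_prox (hη : ∀ γ u, 0 ≤ γ → SlopeOptimal lam γ u (η γ u)) {χ : ℝ} (hχ : 0 ≤ χ) :
    Continuous (η χ) := by
  refine continuous_pi fun i => continuous_iff_continuousAt.2 fun u => ?_
  refine tendsto_of_sq_sub_le (g := fun u' => (u' - u) ⬝ᵥ (u' - u)) ?_ ?_
  · refine Eventually.of_forall fun u' => ?_
    exact (sq_apply_le_dotProduct_self (η χ u' - η χ u) i).trans
      ((hη χ u' hχ).nonexpansive (hη χ u hχ))
  · have : Continuous fun u' : Fin n → ℝ => (u' - u) ⬝ᵥ (u' - u) := by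
      unfold dotProduct; fun_prop
    simpa using this.tendsto u

lemma continuousOn_prox_parameter (hlam : Antitone lam) (hnn : ∀ i, 0 ≤ lam i)
    (hη : ∀ γ u, 0 ≤ γ → SlopeOptimal lam γ u (η γ u)) (u : Fin n → ℝ) :
    ContinuousOn (fun χ => η χ u) (Set.Ici 0) := by
  refine continuousOn_pi.2 fun i χ hχ => ?_
  refine tendsto_of_sq_sub_le (g := fun χ' => n * (|χ' - χ| * ∑ i, lam i) ^ 2) ?_ ?_
  · filter_upwards [self_mem_nhdsWithin] with χ' hχ'
    exact (sq_apply_le_dotProduct_self (η χ' u - η χ u) i).trans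
      ((hη χ' u hχ').parameter_lipschitz hlam hnn (hη χ u hχ))
  · have : Continuous fun χ' : ℝ => n * (|χ' - χ| * ∑ i, lam i) ^ 2 := by fun_prop
    simpa using (this.tendsto χ).mono_left nhdsWithin_le_nhds

lemma sqError_le (hnn : ∀ i, 0 ≤ lam i) (hη : ∀ γ u, 0 ≤ γ → SlopeOptimal lam γ u (η γ u))
    (x : Fin n → ℝ) {χ K : ℝ} (hχ : 0 ≤ χ) (hK : χ ≤ K) (t : ℝ) (h : Fin n → ℝ) :
    sqError η x χ t h ≤ 2 * (∑ i, h i ^ 2) + 2 * (n * (K * ∑ i, lam i) ^ 2) := by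
  have h1 := (hη χ (t • x + h) hχ).residual_le hnn hχ
  have h2 : (n : ℝ) * (χ * ∑ i, lam i) ^ 2 ≤ n * (K * ∑ i, lam i) ^ 2 := by
    have := Finset.sum_nonneg fun i (_ : i ∈ Finset.univ) => hnn i
    gcongr
  set r := t • x + h - η χ (t • x + h) with hr
  have h3 : sqError η x χ t h = ∑ i, (h i - r i) ^ 2 := by
    refine Finset.sum_congr rfl fun i _ => ?_
    simp only [hr, Pi.sub_apply, Pi.add_apply, Pi.smul_apply, smul_eq_mul]
    ring
  have h4 : ∑ i, (h i - r i) ^ 2 ≤ ∑ i, (2 * h i ^ 2 + 2 * (r i * r i)) :=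
    Finset.sum_le_sum fun i _ => by nlinarith [sq_nonneg (h i + r i)]
  rw [Finset.sum_add_distrib, ← Finset.mul_sum, ← Finset.mul_sum] at h4
  change _ ≤ _ + 2 * (r ⬝ᵥ r) at h4
  linarith

end Error

/-! ### Gaussian moments -/

instance (n : ℕ) : IsProbabilityMeasure (stdGaussian n : Measure (Fin n → ℝ)) := by
  unfold _root_.stdGaussian; infer_instance

lemma integrable_gaussianReal_sq_sub (c : ℝ) :
    Integrable (fun y : ℝ => (y - c) ^ 2) (gaussianReal 0 1) :=
  MemLp.integrable_sq ((memLp_id_gaussianReal 2).sub (memLp_const c))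

lemma integral_gaussianReal_sq_sub (c : ℝ) :
    ∫ y : ℝ, (y - c) ^ 2 ∂ gaussianReal 0 1 = 1 + c ^ 2 := by
  have hid : Integrable (fun y : ℝ => y) (gaussianReal 0 1) :=
    (memLp_id_gaussianReal 1).integrable (by simp)
  have hsq : Integrable (fun y : ℝ => y ^ 2) (gaussianReal 0 1) := by
    simpa using integrable_gaussianReal_sq_sub 0
  have hm : ∫ y : ℝ, y ∂ gaussianReal 0 1 = 0 := integral_id_gaussianReal
  have hv : ∫ y : ℝ, y ^ 2 ∂ gaussianReal 0 1 = 1 := by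
    have := variance_id_gaussianReal (μ := 0) (v := 1)
    rw [variance_eq_integral aemeasurable_id] at this
    simpa [hm] using this
  have hcm := hid.const_mul (2 * c)
  have : (fun y : ℝ => (y - c) ^ 2) = fun y => (y ^ 2 - 2 * c * y) + c ^ 2 := by
    ext y; ring
  rw [this, integral_add (f := fun y : ℝ => y ^ 2 - 2 * c * y) (hsq.sub hcm) (integrable_const _),
    integral_sub hsq hcm, integral_const_mul, hm, hv]
  simp

lemma integrable_stdGaussian_sq_sub {n : ℕ} (i : Fin n) (c : ℝ) :
    Integrable (fun h : Fin n → ℝ => (h i - c) ^ 2) (stdGaussian n) :=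
  integrable_comp_eval (μ := fun _ : Fin n => gaussianReal 0 1) (i := i)
    (integrable_gaussianReal_sq_sub c)

lemma integral_stdGaussian_sq_sub {n : ℕ} (i : Fin n) (c : ℝ) :
    ∫ h : Fin n → ℝ, (h i - c) ^ 2 ∂ stdGaussian n = 1 + c ^ 2 := by
  rw [← integral_gaussianReal_sq_sub c]
  exact integral_comp_eval (μ := fun _ : Fin n => gaussianReal 0 1) (i := i)
    (f := fun y : ℝ => (y - c) ^ 2) (integrable_gaussianReal_sq_sub c).aestronglyMeasurable

lemma integrable_stdGaussian_sum_sq (n : ℕ) :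
    Integrable (fun h : Fin n → ℝ => ∑ i, h i ^ 2) (stdGaussian n) :=
  integrable_finsetSum _ fun i _ => by simpa using integrable_stdGaussian_sq_sub i 0

lemma map_stdGaussian_comp {m n : ℕ} {ι : Fin m → Fin n} (hι : ι.Injective) :
    (stdGaussian n : Measure (Fin n → ℝ)).map (fun h j => h (ι j)) = stdGaussian m := by
  have h1 : iIndepFun (fun (i : Fin n) (h : Fin n → ℝ) => h i) (stdGaussian n) :=
    iIndepFun_pi (X := fun _ => id) fun _ => aemeasurable_id
  have h2 := h1.precomp hι
  rw [iIndepFun_iff_map_fun_eq_pi_map (fun i => (measurable_pi_apply _).aemeasurable)] at h2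
  rw [h2, _root_.stdGaussian]
  congr 1
  funext i
  exact (measurePreserving_eval (fun _ : Fin n => gaussianReal 0 1) (ι i)).map_eq

section Mean

variable {n : ℕ} {lam : Fin n → ℝ} {η : ℝ → (Fin n → ℝ) → (Fin n → ℝ)}

lemma continuous_sqError (hη : ∀ γ u, 0 ≤ γ → SlopeOptimal lam γ u (η γ u)) (x : Fin n → ℝ)
    {χ : ℝ} (hχ : 0 ≤ χ) (t : ℝ) : Continuous (sqError η x χ t) := by
  have := continuous_prox hη hχ
  unfold sqError
  fun_prop

lemma integrable_sqError_bound (n : ℕ) (C : ℝ) :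
    Integrable (fun h : Fin n → ℝ => 2 * (∑ i, h i ^ 2) + C) (stdGaussian n) :=
  ((integrable_stdGaussian_sum_sq n).const_mul 2).add (integrable_const _)

lemma integrable_sqError (hnn : ∀ i, 0 ≤ lam i)
    (hη : ∀ γ u, 0 ≤ γ → SlopeOptimal lam γ u (η γ u)) (x : Fin n → ℝ)
    {χ : ℝ} (hχ : 0 ≤ χ) (t : ℝ) : Integrable (sqError η x χ t) (stdGaussian n) := by
  refine (integrable_sqError_bound n (2 * (n * (χ * ∑ i, lam i) ^ 2))).mono'
    (continuous_sqError hη x hχ t).aestronglyMeasurable (Eventually.of_forall fun h => ?_)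
  rw [Real.norm_of_nonneg (sqError_nonneg _ _ _ _)]
  exact sqError_le hnn hη x hχ le_rfl t h

lemma meanSqError_mono (hnn : ∀ i, 0 ≤ lam i)
    (hη : ∀ γ u, 0 ≤ γ → SlopeOptimal lam γ u (η γ u)) (x : Fin n → ℝ)
    {χ : ℝ} (hχ : 0 ≤ χ) : MonotoneOn (meanSqError η x χ) (Set.Ici 0) := by
  intro s hs t _ hst
  refine integral_mono (integrable_sqError hnn hη x hχ s) (integrable_sqError hnn hη x hχ t)
    fun h => ?_
  simp only [sqError_eq_dotProduct]
  exact (hη χ _ hχ).error_mono hs hst (hη χ _ hχ)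

lemma continuousOn_meanSqError (hlam : Antitone lam) (hnn : ∀ i, 0 ≤ lam i)
    (hη : ∀ γ u, 0 ≤ γ → SlopeOptimal lam γ u (η γ u)) (x : Fin n → ℝ) (t K : ℝ) :
    ContinuousOn (fun χ => meanSqError η x χ t) (Set.Icc 0 K) := by
  refine continuousOn_of_dominated
    (fun χ hχ => (continuous_sqError hη x hχ.1 t).aestronglyMeasurable)
    (fun χ hχ => Eventually.of_forall fun h => ?_)
    (integrable_sqError_bound n (2 * (n * (K * ∑ i, lam i) ^ 2)))
    (Eventually.of_forall fun h => ?_)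
  · rw [Real.norm_of_nonneg (sqError_nonneg _ _ _ _)]
    exact sqError_le hnn hη x hχ.1 hχ.2 t h
  · have := continuousOn_pi.1 ((continuousOn_prox_parameter hlam hnn hη (t • x + h)).mono
      (fun χ (hχ : χ ∈ Set.Icc 0 K) => hχ.1))
    unfold sqError
    exact continuousOn_finsetSum _ fun i _ => ((this i).sub continuousOn_const).pow 2

/-- For a large threshold the estimator nearly vanishes, so the error is nearly `‖t x‖²`. -/
lemma exists_le_meanSqError (hlam : Antitone lam) (hnn : ∀ i, 0 ≤ lam i) {i₀ : Fin n}
    (hpos : 0 < lam i₀) (hη : ∀ γ u, 0 ≤ γ → SlopeOptimal lam γ u (η γ u)) {x : Fin n → ℝ}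
    (hx : x ≠ 0) (B : ℝ) :
    ∃ K T : ℝ, 0 ≤ T ∧ ∀ χ, K ≤ χ → B ≤ meanSqError η x χ T := by
  set S := x ⬝ᵥ x with hS
  set X := ∑ j, |x j| with hX
  have hSpos : 0 < S := lt_of_le_of_ne (dotProduct_self_nonneg' x)
    fun h => hx (dotProduct_self_eq_zero.1 h.symm)
  have hXnn : 0 ≤ X := Finset.sum_nonneg fun _ _ => abs_nonneg _
  set T := (|B| + 1) / S + 1 with hT
  have hT1 : 1 ≤ T := by
    have : 0 ≤ (|B| + 1) / S := by positivity
    linarith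
  have hT0 : 0 ≤ T := by linarith
  have hTS : B + 1 ≤ T ^ 2 * S := by
    have h1 : T * S = |B| + 1 + S := by rw [hT]; field_simp
    nlinarith [le_abs_self B, mul_nonneg (sub_nonneg.2 hT1) (mul_nonneg hT0 hSpos.le)]
  set C := T * X * (T ^ 2 * S + n) / lam i₀ with hC
  have hCnn : 0 ≤ C := by positivity
  refine ⟨C + 1, T, hT0, fun χ hχ => ?_⟩
  have hχ0 : 0 < χ := by linarith
  have hpt : ∀ h : Fin n → ℝ, T ^ 2 * S -
      T * X / (χ * lam i₀) * (T ^ 2 * S + ∑ i, h i ^ 2) ≤ sqError η x χ T h := by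
    intro h
    set u := T • x + h with hu
    set v := η χ u with hv
    have hopt : SlopeOptimal lam χ u v := hη χ u hχ0.le
    have huu : u ⬝ᵥ u ≤ 2 * (T ^ 2 * S) + 2 * ∑ i, h i ^ 2 := by
      have h1 := dotProduct_self_nonneg' (T • x - h)
      have h2 : ∑ i, h i ^ 2 = h ⬝ᵥ h := by simp [dotProduct, pow_two]
      rw [h2, hu]
      simp only [sub_dotProduct, dotProduct_sub, add_dotProduct, dotProduct_add, smul_dotProduct,
        dotProduct_smul, smul_eq_mul, dotProduct_comm h x, ← hS] at h1 ⊢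
      linarith
    have hN : χ * slopeNorm lam v ≤ (u ⬝ᵥ u) / 4 := by
      have h1 := hopt.2
      have h2 := dotProduct_self_nonneg' (u - (2 : ℝ) • v)
      simp only [sub_dotProduct, dotProduct_sub, smul_dotProduct, dotProduct_smul, smul_eq_mul,
        dotProduct_comm v u] at h1 h2
      linarith
    have hvj : ∀ j, |v j| ≤ (u ⬝ᵥ u) / 4 / (χ * lam i₀) := fun j => by
      rw [le_div_iff₀ (by positivity)]
      have := mul_le_mul_of_nonneg_left (mul_abs_le_slopeNorm hlam hnn v i₀ j) hχ0.le
      linarith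
    have hvx : v ⬝ᵥ x ≤ (u ⬝ᵥ u) / 4 / (χ * lam i₀) * X := by
      rw [hX, Finset.mul_sum]
      refine Finset.sum_le_sum fun j _ => (le_abs_self _).trans ?_
      rw [abs_mul]
      exact mul_le_mul_of_nonneg_right (hvj j) (abs_nonneg _)
    have herr : T ^ 2 * S - 2 * T * (v ⬝ᵥ x) ≤ sqError η x χ T h := by
      rw [sqError_eq_dotProduct, ← hu, ← hv]
      have := dotProduct_self_nonneg' v
      simp only [sub_dotProduct, dotProduct_sub, smul_dotProduct, dotProduct_smul, smul_eq_mul,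
        dotProduct_comm x v, ← hS]
      linarith
    have hlast : 2 * T * (v ⬝ᵥ x) ≤ T * X / (χ * lam i₀) * (T ^ 2 * S + ∑ i, h i ^ 2) := by
      calc 2 * T * (v ⬝ᵥ x) ≤ 2 * T * ((u ⬝ᵥ u) / 4 / (χ * lam i₀) * X) := by gcongr
        _ = T * X / (χ * lam i₀) * ((u ⬝ᵥ u) / 2) := by ring
        _ ≤ _ := by
          refine mul_le_mul_of_nonneg_left ?_ (by positivity)
          linarith
    linarith
  have hsum : ∫ h : Fin n → ℝ, ∑ i, h i ^ 2 ∂ stdGaussian n = n := by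
    rw [integral_finsetSum _ fun i _ => by simpa using integrable_stdGaussian_sq_sub i 0]
    have : ∀ i : Fin n, ∫ h : Fin n → ℝ, h i ^ 2 ∂ stdGaussian n = 1 := fun i => by
      simpa using integral_stdGaussian_sq_sub i 0
    simp [this]
  have hi := ((integrable_const (T ^ 2 * S)).add (integrable_stdGaussian_sum_sq n)).const_mul
    (T * X / (χ * lam i₀))
  have hle := integral_mono (μ := (stdGaussian n : Measure (Fin n → ℝ)))
    ((integrable_const (T ^ 2 * S)).sub hi) (integrable_sqError hnn hη x hχ0.le T) hpt
  have heq : ∫ h : Fin n → ℝ, (T ^ 2 * S - T * X / (χ * lam i₀) * (T ^ 2 * S + ∑ i, h i ^ 2))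
      ∂ stdGaussian n = T ^ 2 * S - T * X / (χ * lam i₀) * (T ^ 2 * S + n) := by
    have hi' : Integrable (fun h : Fin n → ℝ =>
      T * X / (χ * lam i₀) * (T ^ 2 * S + ∑ i, h i ^ 2)) (stdGaussian n) := hi
    rw [integral_sub (integrable_const _) hi', integral_const_mul (T * X / (χ * lam i₀)),
      integral_add (integrable_const _) (integrable_stdGaussian_sum_sq n), hsum]
    simp
  have hsmall : T * X / (χ * lam i₀) * (T ^ 2 * S + n) ≤ 1 := by
    have : T * X / (χ * lam i₀) * (T ^ 2 * S + n) = C / χ := by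
      rw [hC]; field_simp
    rw [this, div_le_one hχ0]
    linarith
  have hle' : T ^ 2 * S - T * X / (χ * lam i₀) * (T ^ 2 * S + n) ≤ meanSqError η x χ T :=
    heq.symm.trans_le hle
  linarith

end Mean

section Limit

variable {k q : ℕ} {lam : Fin (k + q) → ℝ} {lamq : Fin q → ℝ}
  {η : ℝ → (Fin (k + q) → ℝ) → (Fin (k + q) → ℝ)} {ηq : ℝ → (Fin q → ℝ) → (Fin q → ℝ)}

lemma integral_sum_sq_sub (π : Equiv.Perm (Fin (k + q))) {χ : ℝ} {s : Fin k → ℝ}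
    (hs : ∀ i, |s i| = 1) :
    ∫ h : Fin (k + q) → ℝ, ∑ i, (h (π (Fin.castAdd q i)) - χ * (s i * lam (Fin.castAdd q i))) ^ 2
      ∂ stdGaussian (k + q) = k + χ ^ 2 * ∑ i : Fin k, lam (Fin.castAdd q i) ^ 2 := by
  rw [integral_finsetSum _ fun i _ => integrable_stdGaussian_sq_sub _ _]
  simp only [integral_stdGaussian_sq_sub, Finset.sum_add_distrib, Finset.mul_sum]
  simp only [Finset.sum_const, Finset.card_univ, Fintype.card_fin, nsmul_eq_mul, mul_one]
  congr 1
  refine Finset.sum_congr rfl fun i _ => ?_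
  rw [mul_pow, mul_pow, ← sq_abs (s i), hs]
  ring

lemma tendsto_meanSqError (hlam : Antitone lam) (hnn : ∀ i, 0 ≤ lam i)
    (hq : ∀ j, lamq j = lam (Fin.natAdd k j))
    (hη : ∀ γ u, 0 ≤ γ → SlopeOptimal lam γ u (η γ u))
    (hηq : ∀ γ u, 0 ≤ γ → SlopeOptimal lamq γ u (ηq γ u)) (π : Equiv.Perm (Fin (k + q)))
    {x : Fin (k + q) → ℝ}
    (hx : ∀ i, 0 < |x (π (Fin.castAdd q i))|) (hx0 : ∀ j, x (π (Fin.natAdd k j)) = 0)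
    (hanti : ∀ i j : Fin k, i < j → |x (π (Fin.castAdd q j))| < |x (π (Fin.castAdd q i))|)
    {χ : ℝ} (hχ : 0 ≤ χ) :
    Tendsto (meanSqError η x χ) atTop (nhds (k + χ ^ 2 * ∑ i : Fin k, lam (Fin.castAdd q i) ^ 2 +
      meanSqError ηq 0 χ 0)) := by
  set s : Fin k → ℝ := fun i => x (π (Fin.castAdd q i)) / |x (π (Fin.castAdd q i))|
  have hs : ∀ i, |s i| = 1 := fun i => by
    simp only [s, abs_div, abs_abs]
    exact div_self (hx i).ne'
  have hsx : ∀ i, s i * x (π (Fin.castAdd q i)) = |x (π (Fin.castAdd q i))| := fun i => by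
    simp only [s]
    rw [div_mul_eq_mul_div, ← abs_mul_abs_self, mul_div_assoc, div_self (hx i).ne', mul_one]
  have hnnq : ∀ j, 0 ≤ lamq j := fun j => by rw [hq]; exact hnn _
  have hinj : Function.Injective fun j : Fin q => π (Fin.natAdd k j) :=
    π.injective.comp (Fin.natAdd_injective _ _)
  have hmeas : Measurable fun (h : Fin (k + q) → ℝ) (j : Fin q) => h (π (Fin.natAdd k j)) := by
    fun_prop
  have hint := integrable_sqError hnnq hηq 0 hχ 0
  rw [← map_stdGaussian_comp hinj] at hint
  have hqe : meanSqError ηq 0 χ 0 = ∫ h : Fin (k + q) → ℝ,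
      sqError ηq 0 χ 0 (fun j => h (π (Fin.natAdd k j))) ∂ stdGaussian (k + q) := by
    rw [meanSqError, ← map_stdGaussian_comp hinj,
      integral_map hmeas.aemeasurable hint.aestronglyMeasurable]
  have hintc : Integrable (fun h : Fin (k + q) → ℝ =>
      sqError ηq 0 χ 0 (fun j => h (π (Fin.natAdd k j)))) (stdGaussian (k + q)) :=
    hint.comp_measurable hmeas
  rw [hqe, ← integral_sum_sq_sub (lam := lam) π hs, ← integral_add
    (integrable_finsetSum _ fun i _ => integrable_stdGaussian_sq_sub _ _) hintc]
  refine tendsto_integral_filter_of_dominated_convergence _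
    (Eventually.of_forall fun t => (continuous_sqError hη x hχ t).aestronglyMeasurable)
    (Eventually.of_forall fun t => Eventually.of_forall fun h => ?_)
    (integrable_sqError_bound _ (2 * ((k + q : ℕ) * (χ * ∑ i, lam i) ^ 2)))
    (Eventually.of_forall fun h => ?_)
  · rw [Real.norm_of_nonneg (sqError_nonneg _ _ _ _)]
    exact sqError_le hnn hη x hχ le_rfl t h
  · refine tendsto_nhds_of_eventually_eq ?_
    filter_upwards [eventually_error_eq hlam hnn hq π hs hsx hx hx0 hanti hχ h
      (hηq χ _ hχ) fun t => hη χ (t • x + h) hχ] with t ht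
    rw [sqError, ht]
    simp [sqError]

end Limit

/-! ### Exchanging the limit and the infimum -/

lemma exists_forall_le_of_monotone {G : ℝ → ℝ → ℝ} {L : ℝ → ℝ} {m : ℝ}
    (hmono : ∀ χ, 0 ≤ χ → MonotoneOn (G χ) (Set.Ici 0))
    (hlim : ∀ χ, 0 ≤ χ → Tendsto (G χ) atTop (nhds (L χ)))
    (hcont : ∀ t K, ContinuousOn (fun χ => G χ t) (Set.Icc 0 K))
    (hlarge : ∃ K T, 0 ≤ T ∧ ∀ χ, K ≤ χ → m ≤ G χ T)
    (hm : ∀ χ, 0 ≤ χ → m ≤ L χ) {ε : ℝ} (hε : 0 < ε) :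
    ∃ T, 0 ≤ T ∧ ∀ χ, 0 ≤ χ → ∀ t, T ≤ t → m - ε ≤ G χ t := by
  obtain ⟨K, T₁, hT₁, hK⟩ := hlarge
  have hcpt : ∃ T, 0 ≤ T ∧ ∀ χ ∈ Set.Icc 0 K, ∀ t, T ≤ t → m - ε ≤ G χ t := by
    refine isCompact_Icc.induction_on
      (p := fun s => ∃ T, 0 ≤ T ∧ ∀ χ ∈ s, ∀ t, T ≤ t → m - ε ≤ G χ t)
      ⟨0, le_rfl, by simp⟩ ?_ ?_ ?_
    · rintro s t hst ⟨T, h0, h⟩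
      exact ⟨T, h0, fun χ hχ => h χ (hst hχ)⟩
    · rintro s t ⟨T, h0, h⟩ ⟨T', h0', h'⟩
      refine ⟨max T T', le_max_of_le_left h0, fun χ hχ r hr => ?_⟩
      rcases hχ with hχ | hχ
      · exact h χ hχ r ((le_max_left _ _).trans hr)
      · exact h' χ hχ r ((le_max_right _ _).trans hr)
    · intro χ hχ
      have h1 : m - ε < L χ := by linarith [hm χ hχ.1]
      obtain ⟨T, hT, hT0⟩ := (((hlim χ hχ.1).eventually (lt_mem_nhds h1)).and
        (eventually_ge_atTop 0)).exists
      have h2 := (hcont T K χ hχ).eventually (lt_mem_nhds hT)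
      refine ⟨{y | m - ε < G y T} ∩ Set.Icc 0 K, inter_mem h2 self_mem_nhdsWithin, T, hT0, ?_⟩
      rintro y ⟨hy, hyI⟩ t ht
      exact (le_of_lt hy).trans (hmono y hyI.1 hT0 (hT0.trans ht) ht)
  obtain ⟨T₂, hT₂, h⟩ := hcpt
  refine ⟨max T₁ T₂, le_max_of_le_left hT₁, fun χ hχ t ht => ?_⟩
  have ht1 := (le_max_left _ _).trans ht
  rcases le_total K χ with hKχ | hKχ
  · have := hmono χ hχ hT₁ (hT₁.trans ht1) ht1
    linarith [hK χ hKχ]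
  · exact h χ ⟨hχ, hKχ⟩ t ((le_max_right _ _).trans ht)

/-- The fixed-point equation in the small noise limit, given the behaviour of the normalized
risk. -/
lemma tendsto_of_fixedPoint {δ M : ℝ} (hδ : 0 < δ) (hM : M < δ) {σ r : ℝ → ℝ}
    (hσ : ∀ z, 0 < z → 0 < σ z ∧ σ z ^ 2 = z ^ 2 + σ z ^ 2 * r (σ z) / δ)
    (hle : ∀ s, 0 < s → r s ≤ M) (hr : Tendsto r (nhdsWithin 0 (Set.Ioi 0)) (nhds M)) :
    Tendsto (fun z => δ * (σ z ^ 2 - z ^ 2) / z ^ 2) (nhdsWithin 0 (Set.Ioi 0))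
      (nhds (δ * M / (δ - M))) := by
  have hpos : 0 < δ - M := sub_pos.2 hM
  have hsq : ∀ z, 0 < z → σ z ^ 2 * (δ - r (σ z)) = δ * z ^ 2 := fun z hz => by
    have := (hσ z hz).2
    field_simp at this
    linarith
  have hσ0 : Tendsto σ (nhdsWithin 0 (Set.Ioi 0)) (nhdsWithin 0 (Set.Ioi 0)) := by
    refine tendsto_nhdsWithin_iff.2 ⟨tendsto_of_sq_sub_le (g := fun z => δ / (δ - M) * z ^ 2) ?_ ?_,
      ?_⟩
    · filter_upwards [self_mem_nhdsWithin] with z hz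
      rw [sub_zero, div_mul_eq_mul_div, le_div_iff₀ hpos, ← hsq z hz]
      exact mul_le_mul_of_nonneg_left (by linarith [hle _ (hσ z hz).1]) (sq_nonneg _)
    · have : Continuous fun z : ℝ => δ / (δ - M) * z ^ 2 := by fun_prop
      simpa using (this.tendsto 0).mono_left nhdsWithin_le_nhds
    · filter_upwards [self_mem_nhdsWithin] with z hz using (hσ z hz).1
  have hrσ := hr.comp hσ0
  refine ((hrσ.const_mul δ).div (hrσ.const_sub δ) hpos.ne').congr' ?_
  filter_upwards [self_mem_nhdsWithin] with z hz
  have hz0 : z ≠ 0 := ne_of_gt hz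
  have h1 := hsq z hz
  have h2 : δ - r (σ z) ≠ 0 := by linarith [hle _ (hσ z hz).1]
  simp only [Function.comp, Pi.div_apply]
  rw [div_eq_div_iff h2 (pow_ne_zero 2 hz0)]
  linear_combination (-δ) * h1

lemma slope_limit_of_sorted {k q : ℕ} {lam : Fin (k + q) → ℝ} {lamq : Fin q → ℝ}
    (hlam : Antitone lam) (hnn : ∀ i, 0 ≤ lam i) (hq : ∀ j, lamq j = lam (Fin.natAdd k j))
    {i₀ : Fin (k + q)} (hpos : 0 < lam i₀)
    {η : ℝ → (Fin (k + q) → ℝ) → (Fin (k + q) → ℝ)} {ηq : ℝ → (Fin q → ℝ) → (Fin q → ℝ)}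
    (hη : ∀ γ u, 0 ≤ γ → SlopeOptimal lam γ u (η γ u))
    (hηq : ∀ γ u, 0 ≤ γ → SlopeOptimal lamq γ u (ηq γ u)) (π : Equiv.Perm (Fin (k + q)))
    {x : Fin (k + q) → ℝ} (hxne : x ≠ 0)
    (hx : ∀ i, 0 < |x (π (Fin.castAdd q i))|) (hx0 : ∀ j, x (π (Fin.natAdd k j)) = 0)
    (hanti : ∀ i j : Fin k, i < j → |x (π (Fin.castAdd q j))| < |x (π (Fin.castAdd q i))|)
    {δ M : ℝ} (hδ : 0 < δ)
    (hM : M = (1 / ((k + q : ℕ) : ℝ)) * sInf {m : ℝ | ∃ α : ℝ, 0 < α ∧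
      m = (k : ℝ) + α ^ 2 * (∑ i : Fin (k + q), if (i : ℕ) < k then lam i ^ 2 else 0)
        + ∫ ht, (∑ i, (ηq α ht i) ^ 2) ∂ stdGaussian q})
    (hPT : M < δ) {σs : ℝ → ℝ}
    (hσs : ∀ σz : ℝ, 0 < σz → 0 < σs σz ∧
      (σs σz) ^ 2 = σz ^ 2 + (1 / (δ * ((k + q : ℕ) : ℝ))) * sInf {m : ℝ | ∃ χ : ℝ, 0 < χ ∧
        m = ∫ h, (∑ i, (η (σs σz * χ) (fun j => x j + σs σz * h j) i - x i) ^ 2)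
          ∂ stdGaussian (k + q)}) :
    Tendsto (fun σz => δ * ((σs σz) ^ 2 - σz ^ 2) / σz ^ 2)
      (nhdsWithin 0 (Set.Ioi 0)) (nhds (δ * M / (δ - M))) := by
  have hnnq : ∀ j, 0 ≤ lamq j := fun j => by rw [hq]; exact hnn _
  have hlamq : Antitone lamq := fun i j hij => by
    rw [hq, hq]
    exact hlam (Fin.le_def.2 (by simpa using hij))
  have hp0 : (0 : ℝ) < ((k + q : ℕ) : ℝ) := by
    exact_mod_cast (Nat.zero_le _).trans_lt i₀.isLt
  set L : ℝ → ℝ := fun χ => k + χ ^ 2 * ∑ i : Fin k, lam (Fin.castAdd q i) ^ 2 +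
    meanSqError ηq 0 χ 0 with hL
  have hLnn : ∀ χ, 0 ≤ L χ := fun χ => by
    have : 0 ≤ meanSqError ηq 0 χ 0 := integral_nonneg fun h => sqError_nonneg _ _ _ _
    have : 0 ≤ χ ^ 2 * ∑ i : Fin k, lam (Fin.castAdd q i) ^ 2 :=
      mul_nonneg (sq_nonneg _) (Finset.sum_nonneg fun _ _ => sq_nonneg _)
    simp only [hL]
    positivity
  set m := sInf (L '' Set.Ioi 0) with hmdef
  have hMm : M = m / ((k + q : ℕ) : ℝ) := by
    rw [hM, one_div_mul_eq_div, hmdef]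
    congr 2
    ext y
    simp only [Set.mem_ofPred_eq, Set.mem_image, Set.mem_Ioi, hL, meanSqError, sqError,
      Fin.sum_univ_add]
    simp [eq_comm]
  have hbdd : BddBelow (L '' Set.Ioi 0) := ⟨0, by rintro _ ⟨χ, _, rfl⟩; exact hLnn χ⟩
  have hmpos : ∀ χ, 0 < χ → m ≤ L χ := fun χ hχ => csInf_le hbdd ⟨χ, hχ, rfl⟩
  have hLcont : ContinuousOn L (Set.Icc 0 1) :=
    ContinuousOn.add (by fun_prop) (continuousOn_meanSqError hlamq hnnq hηq 0 0 1)
  have hm : ∀ χ, 0 ≤ χ → m ≤ L χ := fun χ hχ => by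
    rcases hχ.eq_or_lt with rfl | hχ
    · have h1 : Tendsto L (nhdsWithin 0 (Set.Ioc 0 1)) (nhds (L 0)) :=
        (hLcont 0 (by simp)).mono_left (nhdsWithin_mono _ Set.Ioc_subset_Icc_self)
      have : (nhdsWithin (0 : ℝ) (Set.Ioc 0 1)).NeBot := by
        rw [nhdsWithin_Ioc_eq_nhdsGT zero_lt_one]; infer_instance
      refine ge_of_tendsto h1 ?_
      filter_upwards [self_mem_nhdsWithin] with χ hχ using hmpos χ hχ.1
    · exact hmpos χ hχ
  have hmono := fun χ (hχ : 0 ≤ χ) => meanSqError_mono hnn hη x hχ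
  have hlim := fun χ (hχ : 0 ≤ χ) => tendsto_meanSqError hlam hnn hq hη hηq π hx hx0 hanti hχ
  have hGle : ∀ χ, 0 ≤ χ → ∀ t, 0 ≤ t → meanSqError η x χ t ≤ L χ := fun χ hχ t ht =>
    ge_of_tendsto (hlim χ hχ) (by
      filter_upwards [eventually_ge_atTop t] with t' ht'
      exact hmono χ hχ ht (ht.trans ht') ht')
  set R : ℝ → ℝ := fun s => sInf ((fun χ => meanSqError η x χ s⁻¹) '' Set.Ioi 0) with hR
  have hRbdd : ∀ s, BddBelow ((fun χ => meanSqError η x χ s⁻¹) '' Set.Ioi 0) := fun s =>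
    ⟨0, by rintro _ ⟨χ, _, rfl⟩; exact integral_nonneg fun h => sqError_nonneg _ _ _ _⟩
  have hRle : ∀ s, 0 < s → R s ≤ m := fun s hs => by
    refine le_csInf (Set.nonempty_Ioi.image _) ?_
    rintro _ ⟨χ, hχ, rfl⟩
    exact (csInf_le (hRbdd s) ⟨χ, hχ, rfl⟩).trans
      (hGle χ (le_of_lt hχ) _ (inv_nonneg.2 hs.le))
  have hRlim : Tendsto R (nhdsWithin 0 (Set.Ioi 0)) (nhds m) := by
    refine tendsto_order.2 ⟨fun a ha => ?_, fun a ha => ?_⟩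
    · obtain ⟨T, -, hT⟩ := exists_forall_le_of_monotone hmono hlim
        (continuousOn_meanSqError hlam hnn hη x) (exists_le_meanSqError hlam hnn hpos hη hxne m)
        hm (half_pos (sub_pos.2 ha))
      filter_upwards [tendsto_inv_nhdsGT_zero.eventually_ge_atTop T] with s hs
      have : m - (m - a) / 2 ≤ R s := by
        refine le_csInf (Set.nonempty_Ioi.image _) ?_
        rintro _ ⟨χ, hχ, rfl⟩
        exact hT χ (le_of_lt hχ) _ hs
      linarith
    · filter_upwards [self_mem_nhdsWithin] with s hs using (hRle s hs).trans_lt ha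
  have hscale : ∀ s, 0 < s → ∀ χ, 0 < χ →
      ∫ h, (∑ i, (η (s * χ) (fun j => x j + s * h j) i - x i) ^ 2) ∂ stdGaussian (k + q) =
        s ^ 2 * meanSqError η x χ s⁻¹ := fun s hs χ hχ => by
    rw [meanSqError, ← integral_const_mul]
    congr 1
    funext h
    have h1 : (fun j => x j + s * h j) = s • (s⁻¹ • x + h) := by
      rw [smul_add, smul_smul, mul_inv_cancel₀ hs.ne', one_smul]
      rfl
    have h2 : η (s * χ) (s • (s⁻¹ • x + h)) = s • η χ (s⁻¹ • x + h) :=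
      (hη _ _ (by positivity)).unique ((hη χ _ hχ.le).smul hlam hs.le)
    rw [h1, h2, sqError, Finset.mul_sum]
    refine Finset.sum_congr rfl fun i _ => ?_
    simp only [Pi.smul_apply, smul_eq_mul]
    field_simp
  have hset : ∀ s, 0 < s → sInf {m : ℝ | ∃ χ : ℝ, 0 < χ ∧
      m = ∫ h, (∑ i, (η (s * χ) (fun j => x j + s * h j) i - x i) ^ 2)
          ∂ stdGaussian (k + q)} = s ^ 2 * R s := fun s hs => by
    rw [hR, ← smul_eq_mul, ← Real.sInf_smul_of_nonneg (sq_nonneg s)]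
    congr 1
    ext y
    simp only [Set.mem_ofPred_eq, Set.mem_smul_set, Set.mem_image, Set.mem_Ioi, smul_eq_mul]
    constructor
    · rintro ⟨χ, hχ, rfl⟩
      exact ⟨_, ⟨χ, hχ, rfl⟩, (hscale s hs χ hχ).symm⟩
    · rintro ⟨_, ⟨χ, hχ, rfl⟩, rfl⟩
      exact ⟨χ, hχ, (hscale s hs χ hχ).symm⟩
  refine tendsto_of_fixedPoint (r := fun s => R s / ((k + q : ℕ) : ℝ)) hδ hPT
    (fun z hz => ⟨(hσs z hz).1, ?_⟩) (fun s hs => ?_) ?_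
  · conv_lhs => rw [(hσs z hz).2, hset _ (hσs z hz).1]
    field_simp
  · rw [hMm]
    exact div_le_div_of_nonneg_right (hRle s hs) hp0.le
  · rw [hMm]
    exact hRlim.div_const _

lemma exists_sorting_perm {p k : ℕ} {x : Fin p → ℝ}
    (hxk : {i : Fin p | x i ≠ 0}.ncard = k)
    (hdistinct : ∀ i j : Fin p, i ≠ j → x i ≠ 0 → x j ≠ 0 → |x i| ≠ |x j|) :
    ∃ π : Equiv.Perm (Fin p), (∀ i : Fin p, x (π i) ≠ 0 ↔ (i : ℕ) < k) ∧
      ∀ i j : Fin p, i < j → (j : ℕ) < k → |x (π j)| < |x (π i)| := by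
  set π := Tuple.sort (fun j => -|x j|)
  have hanti : Antitone fun i => |x (π i)| := antitone_abs_sort x
  have hcard : Finset.card {i | 0 < |x (π i)|} = k := by
    rw [← hxk, Set.ncard_eq_toFinset_card']
    exact Finset.card_equiv π (by simp)
  have hiff : ∀ i : Fin p, x (π i) ≠ 0 ↔ (i : ℕ) < k := fun i => by
    rw [← abs_pos, ← Tuple.lt_card_gt_iff_apply_gt_of_antitone hanti, hcard]
  refine ⟨π, hiff, fun i j hij hj => lt_of_le_of_ne (hanti hij.le) ?_⟩
  refine hdistinct _ _ (π.injective.ne hij.ne') ((hiff j).2 hj) ((hiff i).2 ?_)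
  exact (Fin.lt_def.1 hij).trans hj

/-- above the phase transition (`δ > M_λ`), the optimally tuned
asymptotic MSE of SLOPE satisfies
`lim_{σ_z → 0⁺} δ(σ*(σ_z)² − σ_z²)/σ_z² = δ M_λ / (δ − M_λ)`. -/
theorem slope_low_noise_above_phase_transition
    (p k : ℕ) (hp : 1 ≤ p) (hk1 : 1 ≤ k) (hkp : k ≤ p)
    (lam : Fin p → ℝ)
    (hmono : ∀ i j : Fin p, i ≤ j → lam j ≤ lam i)
    (hnonneg : ∀ i, 0 ≤ lam i)
    (hlam1 : 0 < lam ⟨0, hp⟩)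
    (x : Fin p → ℝ)
    (hxk : {i : Fin p | x i ≠ 0}.ncard = k)
    (hdistinct : ∀ i j : Fin p, i ≠ j → x i ≠ 0 → x j ≠ 0 → |x i| ≠ |x j|)
    (δ : ℝ) (hδ : 0 < δ)
    -- η(·;·) : the SLOPE proximal operator in dimension p with weights λ
    (ηp : ℝ → (Fin p → ℝ) → (Fin p → ℝ))
    (hηp : ∀ γ u, 0 ≤ γ → IsSlopeProx lam γ u (ηp γ u))
    -- λ_{[k+1:p]} and the proximal operator in dimension p − k
    (lamq : Fin (p - k) → ℝ)
    (hlamq : ∀ i : Fin (p - k), lamq i = lam ⟨k + i.val, by have := i.isLt; omega⟩)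
    (ηq : ℝ → (Fin (p - k) → ℝ) → (Fin (p - k) → ℝ))
    (hηq : ∀ γ u, 0 ≤ γ → IsSlopeProx lamq γ u (ηq γ u))
    -- M_λ
    (M : ℝ)
    (hM : M = (1 / (p : ℝ)) * sInf {m : ℝ | ∃ α : ℝ, 0 < α ∧
      m = (k : ℝ) + α ^ 2 * (∑ i : Fin p, if (i : ℕ) < k then lam i ^ 2 else 0)
        + ∫ ht, (∑ i, (ηq α ht i) ^ 2) ∂ stdGaussian (p - k)})
    (hPT : M < δ)
    -- σ*(σ_z) : a positive solution of the fixed-point equation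
    (σs : ℝ → ℝ)
    (hσs : ∀ σz : ℝ, 0 < σz → 0 < σs σz ∧
      (σs σz) ^ 2 = σz ^ 2 + (1 / (δ * (p : ℝ))) * sInf {m : ℝ | ∃ χ : ℝ, 0 < χ ∧
        m = ∫ h, (∑ i, (ηp (σs σz * χ) (fun j => x j + σs σz * h j) i - x i) ^ 2)
          ∂ stdGaussian p}) :
    Filter.Tendsto (fun σz => δ * ((σs σz) ^ 2 - σz ^ 2) / σz ^ 2)
      (nhdsWithin 0 (Set.Ioi 0)) (nhds (δ * M / (δ - M))) := by
  obtain ⟨q, hq⟩ : ∃ q, q = p - k := ⟨_, rfl⟩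
  have hlam : Antitone lam := fun i j hij => hmono i j hij
  have hlamq' : Antitone lamq := fun i j hij => by
    rw [hlamq, hlamq]
    exact hmono _ _ (Fin.le_def.2 (by simpa using hij))
  have hnnq : ∀ j, 0 ≤ lamq j := fun j => by rw [hlamq]; exact hnonneg _
  have hη := fun γ u (hγ : 0 ≤ γ) => (hηp γ u hγ).optimal hlam hnonneg hγ
  have hη' := fun γ u (hγ : 0 ≤ γ) => (hηq γ u hγ).optimal hlamq' hnnq hγ
  obtain ⟨π, hπ, hπlt⟩ := exists_sorting_perm hxk hdistinct
  have hlamq₀ : ∀ (i : Fin (p - k)) (hi : k + i.val < p), lamq i = lam ⟨k + i.val, hi⟩ :=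
    fun i _ => hlamq i
  clear hlamq hηp hηq hmono hxk hdistinct hlamq' hnnq
  revert lamq ηq
  rw [← hq]
  intro lamq ηq hM hη' hlamq
  obtain rfl : p = k + q := by omega
  refine slope_limit_of_sorted hlam hnonneg (fun j => hlamq j (Fin.natAdd k j).isLt) hlam1 hη hη' π ?_
    (fun i => abs_pos.2 ((hπ _).2 i.isLt)) (fun j => ?_)
    (fun i j hij => hπlt _ _ hij j.isLt) hδ hM hPT hσs
  · rintro rfl
    exact (hπ ⟨0, hp⟩).2 hk1 rfl
  · by_contra h
    have := (hπ _).1 h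
    simp at this
end

section
/- Let p ≥ 1, let λ = (λ₁,…,λ_p) be nonincreasing nonnegative weights, let x ∈ ℝ^p, and fix δ > 0 and σ_z > 0. Let σ* be the unique positive solution of σ² = σ_z² + (1/(δp)) inf_{χ>0} E‖η(x + σh; σχ, λ) − x‖₂². If σ̄ > 0 and χ̄ > 0 satisfy the state evolution equation σ̄² = σ_z² + (1/(δp)) E‖η(x + σ̄h; σ̄χ̄, λ) − x‖₂², then σ̄ ≥ σ*. Consequently, for every tuning, the asymptotic MSE δ(σ̄² − σ_z²) of SLOPE is at least the optimally tuned value δ((σ*)² − σ_z²). -/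
open MeasureTheory ProbabilityTheory Filter

lemma sortedAbs_antitone {n : ℕ} (x : Fin n → ℝ) : Antitone (sortedAbs x) := by
  intro i j hij
  have h := Tuple.monotone_sort (fun j => -|x j|) hij
  simpa [sortedAbs] using h

lemma sum_mul_abs_comp_perm_le_slopeNorm {n : ℕ} {lam : Fin n → ℝ} (hlam : Antitone lam)
    (x : Fin n → ℝ) (π : Equiv.Perm (Fin n)) :
    ∑ i, lam i * |x (π i)| ≤ slopeNorm lam x := by
  have h := (hlam.monovary (sortedAbs_antitone x)).sum_mul_comp_perm_le_sum_mul
    (σ := π.trans (Tuple.sort fun j => -|x j|).symm)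
  simpa [slopeNorm, sortedAbs] using h

lemma slopeNorm_nonneg {n : ℕ} {lam : Fin n → ℝ} (hnonneg : ∀ i, 0 ≤ lam i) (x : Fin n → ℝ) :
    0 ≤ slopeNorm lam x :=
  Finset.sum_nonneg fun i _ => mul_nonneg (hnonneg i) (abs_nonneg _)

/-- Sublinearity of the sorted-ℓ1 norm. -/
lemma slopeNorm_combo_le {n : ℕ} {lam : Fin n → ℝ} (hlam : Antitone lam)
    (hnonneg : ∀ i, 0 ≤ lam i) (v w : Fin n → ℝ) {a b : ℝ} (ha : 0 ≤ a) (hb : 0 ≤ b) :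
    slopeNorm lam (fun i => a * v i + b * w i) ≤ a * slopeNorm lam v + b * slopeNorm lam w := by
  set π := Tuple.sort fun j => -|a * v j + b * w j|
  calc slopeNorm lam (fun i => a * v i + b * w i)
      = ∑ i, lam i * |a * v (π i) + b * w (π i)| := rfl
    _ ≤ ∑ i, (a * (lam i * |v (π i)|) + b * (lam i * |w (π i)|)) := by
        refine Finset.sum_le_sum fun i _ => ?_
        have h := abs_add_le (a * v (π i)) (b * w (π i))
        rw [abs_mul, abs_mul, abs_of_nonneg ha, abs_of_nonneg hb] at h
        nlinarith [mul_le_mul_of_nonneg_left h (hnonneg i)]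
    _ = a * ∑ i, lam i * |v (π i)| + b * ∑ i, lam i * |w (π i)| := by
        rw [Finset.sum_add_distrib, Finset.mul_sum, Finset.mul_sum]
    _ ≤ _ := by
        gcongr <;> exact sum_mul_abs_comp_perm_le_slopeNorm hlam _ π

/-- First-order optimality: `u - v` is a subgradient of `γ‖·‖_λ` at the proximal point `v`. -/
lemma IsSlopeProx.subgradient {n : ℕ} {lam : Fin n → ℝ} (hlam : Antitone lam)
    (hnonneg : ∀ i, 0 ≤ lam i) {γ : ℝ} (hγ : 0 ≤ γ) {u v : Fin n → ℝ}
    (hv : IsSlopeProx lam γ u v) (w : Fin n → ℝ) :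
    ∑ i, (u i - v i) * (w i - v i) ≤ γ * (slopeNorm lam w - slopeNorm lam v) := by
  set A := ∑ i, (u i - v i) * (w i - v i) with hA
  set B := ∑ i, (w i - v i) ^ 2 with hB
  have key : ∀ ε : ℝ, 0 < ε → ε ≤ 1 →
      A ≤ γ * (slopeNorm lam w - slopeNorm lam v) + ε * (B / 2) := by
    intro ε h0 h1
    have h := hv (fun i => (1 - ε) * v i + ε * w i)
    have hN := mul_le_mul_of_nonneg_left
      (slopeNorm_combo_le hlam hnonneg v w (sub_nonneg.2 h1) h0.le) hγ
    have hS : ∑ i, (u i - ((1 - ε) * v i + ε * w i)) ^ 2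
        = ∑ i, (u i - v i) ^ 2 - 2 * ε * A + ε ^ 2 * B := by
      rw [hA, hB, Finset.mul_sum, Finset.mul_sum, ← Finset.sum_sub_distrib,
        ← Finset.sum_add_distrib]
      exact Finset.sum_congr rfl fun i _ => by ring
    simp only [slopeObj, hS] at h
    refine le_of_mul_le_mul_left ?_ h0
    nlinarith
  have hlim : Tendsto (fun ε : ℝ => γ * (slopeNorm lam w - slopeNorm lam v) + ε * (B / 2))
      (nhdsWithin 0 (Set.Ioi 0)) (nhds (γ * (slopeNorm lam w - slopeNorm lam v) + 0 * (B / 2))) :=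
    Continuous.tendsto (by fun_prop) 0 |>.mono_left nhdsWithin_le_nhds
  rw [zero_mul, add_zero] at hlim
  refine ge_of_tendsto hlim ?_
  filter_upwards [Ioc_mem_nhdsGT (zero_lt_one' ℝ)] with ε hε using key ε hε.1 hε.2

lemma IsSlopeProx.sum_mul_self {n : ℕ} {lam : Fin n → ℝ} (hlam : Antitone lam)
    (hnonneg : ∀ i, 0 ≤ lam i) {γ : ℝ} (hγ : 0 ≤ γ) {u v : Fin n → ℝ}
    (hv : IsSlopeProx lam γ u v) :
    ∑ i, (u i - v i) * v i = γ * slopeNorm lam v := by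
  apply le_antisymm
  · have h := hv.subgradient hlam hnonneg hγ (fun i => 2 * v i + 0 * v i)
    have h2 := mul_le_mul_of_nonneg_left
      (slopeNorm_combo_le hlam hnonneg v v zero_le_two le_rfl) hγ
    have e : ∑ i, (u i - v i) * (2 * v i + 0 * v i - v i) = ∑ i, (u i - v i) * v i :=
      Finset.sum_congr rfl fun i _ => by ring
    rw [e] at h
    linarith
  · have h := hv.subgradient hlam hnonneg hγ (fun i => 0 * v i + 0 * v i)
    have h2 := mul_le_mul_of_nonneg_left
      (slopeNorm_combo_le hlam hnonneg v v le_rfl le_rfl) hγ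
    have e : ∑ i, (u i - v i) * (0 * v i + 0 * v i - v i) = -∑ i, (u i - v i) * v i := by
      rw [← Finset.sum_neg_distrib]
      exact Finset.sum_congr rfl fun i _ => by ring
    rw [e] at h
    linarith

lemma IsSlopeProx.sum_mul_le {n : ℕ} {lam : Fin n → ℝ} (hlam : Antitone lam)
    (hnonneg : ∀ i, 0 ≤ lam i) {γ : ℝ} (hγ : 0 ≤ γ) {u v : Fin n → ℝ}
    (hv : IsSlopeProx lam γ u v) (w : Fin n → ℝ) :
    ∑ i, (u i - v i) * w i ≤ γ * slopeNorm lam w := by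
  have h := hv.subgradient hlam hnonneg hγ w
  simp only [mul_sub, Finset.sum_sub_distrib] at h
  have h2 := hv.sum_mul_self hlam hnonneg hγ
  linarith

lemma IsSlopeProx.sum_sq_le {n : ℕ} {lam : Fin n → ℝ} (hlam : Antitone lam)
    (hnonneg : ∀ i, 0 ≤ lam i) {γ : ℝ} (hγ : 0 ≤ γ) {u v : Fin n → ℝ}
    (hv : IsSlopeProx lam γ u v) : ∑ i, v i ^ 2 ≤ ∑ i, u i ^ 2 := by
  have h : 0 ≤ ∑ i, (u i - v i) * v i :=
    (hv.sum_mul_self hlam hnonneg hγ).symm ▸ mul_nonneg hγ (slopeNorm_nonneg hnonneg v)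
  have e : ∑ i, u i ^ 2 = ∑ i, v i ^ 2 + 2 * ∑ i, (u i - v i) * v i + ∑ i, (u i - v i) ^ 2 := by
    rw [Finset.mul_sum, ← Finset.sum_add_distrib, ← Finset.sum_add_distrib]
    exact Finset.sum_congr rfl fun i _ => by ring
  have := Finset.sum_nonneg fun i (_ : i ∈ Finset.univ) => sq_nonneg (u i - v i)
  linarith

/-- The SLOPE proximal operator is nonexpansive. -/
lemma IsSlopeProx.sum_sub_sq_le {n : ℕ} {lam : Fin n → ℝ} (hlam : Antitone lam)
    (hnonneg : ∀ i, 0 ≤ lam i) {γ : ℝ} (hγ : 0 ≤ γ) {u v u' v' : Fin n → ℝ}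
    (hv : IsSlopeProx lam γ u v) (hv' : IsSlopeProx lam γ u' v') :
    ∑ i, (v i - v' i) ^ 2 ≤ ∑ i, (u i - u' i) ^ 2 := by
  have h1 := hv.subgradient hlam hnonneg hγ v'
  have h2 := hv'.subgradient hlam hnonneg hγ v
  have e : ∑ i, (u i - u' i) ^ 2 = ∑ i, (v i - v' i) ^ 2 + ∑ i, ((u i - v i) - (u' i - v' i)) ^ 2
      - 2 * (∑ i, (u i - v i) * (v' i - v i) + ∑ i, (u' i - v' i) * (v i - v' i)) := by
    rw [← Finset.sum_add_distrib, ← Finset.sum_add_distrib, Finset.mul_sum,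
      ← Finset.sum_sub_distrib]
    exact Finset.sum_congr rfl fun i _ => by ring
  have := Finset.sum_nonneg fun i (_ : i ∈ Finset.univ) => sq_nonneg ((u i - v i) - (u' i - v' i))
  linarith

/-- For fixed noise `h`, the error of the proximal estimator relative to the noise level `σ`
decreases as `σ` grows when the threshold is proportional to `σ`. -/
lemma IsSlopeProx.relative_error_antitone {n : ℕ} {lam : Fin n → ℝ} (hlam : Antitone lam)
    (hnonneg : ∀ i, 0 ≤ lam i) {σ τ χ : ℝ} (hσ : 0 < σ) (hστ : σ < τ) (hχ : 0 ≤ χ)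
    {x h v w : Fin n → ℝ} (hv : IsSlopeProx lam (σ * χ) (fun i => x i + σ * h i) v)
    (hw : IsSlopeProx lam (τ * χ) (fun i => x i + τ * h i) w) :
    (∑ i, (w i - x i) ^ 2) / τ ^ 2 ≤ (∑ i, (v i - x i) ^ 2) / σ ^ 2 := by
  have hτ : 0 < τ := hσ.trans hστ
  have hσχ : 0 ≤ σ * χ := by positivity
  have hτχ : 0 ≤ τ * χ := by positivity
  -- `a` and `b` are the residuals divided by the noise level
  obtain ⟨b, hb⟩ : ∃ b : Fin n → ℝ, ∀ i, v i = x i + σ * h i - σ * b i :=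
    ⟨fun i => (x i + σ * h i - v i) / σ, fun i => by field_simp; ring⟩
  obtain ⟨a, ha⟩ : ∃ a : Fin n → ℝ, ∀ i, w i = x i + τ * h i - τ * a i :=
    ⟨fun i => (x i + τ * h i - w i) / τ, fun i => by field_simp; ring⟩
  have dual : ∀ {s t : ℝ}, 0 < s → 0 < t → ∀ {y c d : Fin n → ℝ},
      ∑ i, (s * c i) * y i = s * χ * slopeNorm lam y →
      ∑ i, (t * d i) * y i ≤ t * χ * slopeNorm lam y →
      ∑ i, (d i - c i) * y i ≤ 0 := by
    intro s t hs ht y c d h1 h2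
    simp only [mul_assoc, ← Finset.mul_sum] at h1 h2
    have h1' := mul_left_cancel₀ hs.ne' h1
    have h2' := le_of_mul_le_mul_left h2 ht
    simp only [sub_mul, Finset.sum_sub_distrib]
    linarith
  have rv : ∀ i, x i + σ * h i - v i = σ * b i := fun i => by rw [hb]; ring
  have rw' : ∀ i, x i + τ * h i - w i = τ * a i := fun i => by rw [ha]; ring
  have v1 := hv.sum_mul_self hlam hnonneg hσχ
  have v2 := hv.sum_mul_le hlam hnonneg hσχ w
  have w1 := hw.sum_mul_self hlam hnonneg hτχ
  have w2 := hw.sum_mul_le hlam hnonneg hτχ v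
  simp only [rv, rw'] at v1 v2 w1 w2
  have I1 := dual hσ hτ v1 w2
  have I2 := dual hτ hσ w1 v2
  set X := ∑ i, (b i - a i) * x i with hX
  set H := ∑ i, (b i - a i) * (h i - a i) with hH
  set D := ∑ i, (b i - a i) ^ 2 with hD
  have hD0 : 0 ≤ D := Finset.sum_nonneg fun i _ => sq_nonneg _
  have E1 : ∑ i, (a i - b i) * v i = -X - σ * H + σ * D := by
    rw [hX, hH, hD, Finset.mul_sum, Finset.mul_sum, ← Finset.sum_neg_distrib,
      ← Finset.sum_sub_distrib, ← Finset.sum_add_distrib]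
    exact Finset.sum_congr rfl fun i _ => by rw [hb]; ring
  have E2 : ∑ i, (b i - a i) * w i = X + τ * H := by
    rw [hX, hH, Finset.mul_sum, ← Finset.sum_add_distrib]
    exact Finset.sum_congr rfl fun i _ => by rw [ha]; ring
  have E3 : (∑ i, (v i - x i) ^ 2) / σ ^ 2 = ∑ i, (h i - b i) ^ 2 := by
    rw [Finset.sum_div]
    exact Finset.sum_congr rfl fun i _ => by rw [hb]; field_simp; ring
  have E4 : (∑ i, (w i - x i) ^ 2) / τ ^ 2 = ∑ i, (h i - a i) ^ 2 := by
    rw [Finset.sum_div]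
    exact Finset.sum_congr rfl fun i _ => by rw [ha]; field_simp; ring
  have E5 : ∑ i, (h i - b i) ^ 2 = ∑ i, (h i - a i) ^ 2 + D - 2 * H := by
    rw [hH, hD, Finset.mul_sum, ← Finset.sum_add_distrib, ← Finset.sum_sub_distrib]
    exact Finset.sum_congr rfl fun i _ => by ring
  rw [E3, E4, E5]
  rw [E1] at I1
  rw [E2] at I2
  have hXn : 0 ≤ X := by
    by_contra! hneg
    have h1 : τ * (σ * D) ≤ τ * (X + σ * H) := by gcongr; linarith
    have h2 : σ * (X + τ * H) ≤ σ * 0 := by gcongr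
    nlinarith [mul_nonneg hτ.le (mul_nonneg hσ.le hD0), mul_pos (sub_pos.2 hστ) (neg_pos.2 hneg)]
  have hHn : H ≤ 0 := by
    by_contra! hpos
    nlinarith [mul_pos hτ hpos]
  linarith

lemma continuous_of_isSlopeProx {n : ℕ} {lam : Fin n → ℝ} (hlam : Antitone lam)
    (hnonneg : ∀ i, 0 ≤ lam i) {γ : ℝ} (hγ : 0 ≤ γ) {f : (Fin n → ℝ) → Fin n → ℝ}
    (hf : ∀ u, IsSlopeProx lam γ u (f u)) : Continuous f := by
  rw [continuous_iff_continuousAt]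
  intro u₀
  rw [ContinuousAt, tendsto_iff_dist_tendsto_zero]
  have hlim : Tendsto (fun u : Fin n → ℝ => √(∑ i, (u i - u₀ i) ^ 2)) (nhds u₀)
      (nhds (√(∑ i, (u₀ i - u₀ i) ^ 2))) := Continuous.tendsto (by fun_prop) u₀
  simp only [sub_self, ne_eq, OfNat.ofNat_ne_zero, not_false_eq_true, zero_pow,
    Finset.sum_const_zero, Real.sqrt_zero] at hlim
  refine squeeze_zero (fun _ => dist_nonneg) (fun u => ?_) hlim
  refine (dist_pi_le_iff (Real.sqrt_nonneg _)).2 fun i => ?_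
  rw [Real.dist_eq]
  refine Real.abs_le_sqrt (le_trans ?_ ((hf u).sum_sub_sq_le hlam hnonneg hγ (hf u₀)))
  exact Finset.single_le_sum (f := fun i => (f u i - f u₀ i) ^ 2) (fun j _ => sq_nonneg _)
    (Finset.mem_univ i)

instance isProbabilityMeasure_stdGaussian (n : ℕ) : IsProbabilityMeasure (stdGaussian n) := by
  unfold _root_.stdGaussian
  infer_instance

lemma integrable_sq_eval_stdGaussian {n : ℕ} (i : Fin n) :
    Integrable (fun h : Fin n → ℝ => h i ^ 2) (stdGaussian n) := by
  have h : Integrable (fun y : ℝ => y ^ 2) (gaussianReal 0 1) :=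
    (memLp_id_gaussianReal (μ := 0) (v := 1) 2).integrable_sq
  exact (measurePreserving_eval (fun _ : Fin n => gaussianReal 0 1) i)
    |>.integrable_comp_of_integrable h

lemma integrable_slopeProx_error {n : ℕ} {lam : Fin n → ℝ} (hlam : Antitone lam)
    (hnonneg : ∀ i, 0 ≤ lam i) {γ : ℝ} (hγ : 0 ≤ γ) {f : (Fin n → ℝ) → Fin n → ℝ}
    (hf : ∀ u, IsSlopeProx lam γ u (f u)) (x : Fin n → ℝ) (σ : ℝ) :
    Integrable (fun h => ∑ i, (f (fun j => x j + σ * h j) i - x i) ^ 2) (stdGaussian n) := by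
  have hc := continuous_of_isSlopeProx hlam hnonneg hγ hf
  have hbound : Integrable (fun h : Fin n → ℝ => ∑ i, (6 * x i ^ 2 + 4 * σ ^ 2 * h i ^ 2))
      (stdGaussian n) :=
    integrable_finsetSum _ fun i _ =>
      (integrable_const _).add ((integrable_sq_eval_stdGaussian i).const_mul _)
  refine hbound.mono' (Continuous.aestronglyMeasurable (by fun_prop)) (ae_of_all _ fun h => ?_)
  rw [Real.norm_of_nonneg (Finset.sum_nonneg fun i _ => sq_nonneg _)]
  set v := f (fun j => x j + σ * h j)
  have hv := (hf (fun j => x j + σ * h j)).sum_sq_le hlam hnonneg hγ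
  calc ∑ i, (v i - x i) ^ 2 ≤ ∑ i, (2 * v i ^ 2 + 2 * x i ^ 2) :=
        Finset.sum_le_sum fun i _ => by nlinarith [sq_nonneg (v i + x i)]
    _ = 2 * ∑ i, v i ^ 2 + ∑ i, 2 * x i ^ 2 := by
        rw [Finset.sum_add_distrib, Finset.mul_sum]
    _ ≤ 2 * ∑ i, (x i + σ * h i) ^ 2 + ∑ i, 2 * x i ^ 2 := by gcongr
    _ = ∑ i, (2 * (x i + σ * h i) ^ 2 + 2 * x i ^ 2) := by
        rw [Finset.sum_add_distrib, Finset.mul_sum]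
    _ ≤ _ := Finset.sum_le_sum fun i _ => by nlinarith [sq_nonneg (x i - σ * h i)]

/-- any state-evolution solution `(σ̄, χ̄)` satisfies `σ̄ ≥ σ*`, so the
asymptotic MSE of any tuning is at least the optimally tuned value. -/
theorem slope_optimal_tuning_dominates
    (p : ℕ) (hp : 1 ≤ p)
    (lam : Fin p → ℝ)
    (hmono : ∀ i j : Fin p, i ≤ j → lam j ≤ lam i)
    (hnonneg : ∀ i, 0 ≤ lam i)
    (x : Fin p → ℝ)
    (δ σz : ℝ) (hδ : 0 < δ) (hσz : 0 < σz)
    (η : ℝ → (Fin p → ℝ) → (Fin p → ℝ))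
    (hη : ∀ γ u, 0 ≤ γ → IsSlopeProx lam γ u (η γ u))
    -- σ* : the unique positive solution of the optimally tuned fixed-point equation
    (σstar : ℝ) (hσstar_pos : 0 < σstar)
    (hσstar : σstar ^ 2 = σz ^ 2 + (1 / (δ * (p : ℝ))) *
      sInf {m : ℝ | ∃ χ : ℝ, 0 < χ ∧
        m = ∫ h, (∑ i, (η (σstar * χ) (fun j => x j + σstar * h j) i - x i) ^ 2)
          ∂ stdGaussian p})
    -- (σ̄, χ̄) : a solution of the state evolution equation
    (σbar χbar : ℝ) (hσbar_pos : 0 < σbar) (hχbar_pos : 0 < χbar)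
    (hσbar : σbar ^ 2 = σz ^ 2 + (1 / (δ * (p : ℝ))) *
      ∫ h, (∑ i, (η (σbar * χbar) (fun j => x j + σbar * h j) i - x i) ^ 2)
        ∂ stdGaussian p) :
    σstar ≤ σbar ∧ δ * (σstar ^ 2 - σz ^ 2) ≤ δ * (σbar ^ 2 - σz ^ 2) := by
  set c : ℝ := 1 / (δ * (p : ℝ)) with hc
  have hc0 : 0 ≤ c := by positivity
  have hlam : Antitone lam := fun i j hij => hmono i j hij
  set M : ℝ → ℝ := fun σ => ∫ h, (∑ i, (η (σ * χbar) (fun j => x j + σ * h j) i - x i) ^ 2)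
    ∂ stdGaussian p with hM
  have hopt : σstar ^ 2 ≤ σz ^ 2 + c * M σstar := by
    rw [hσstar]
    gcongr
    refine csInf_le ⟨0, ?_⟩ ⟨χbar, hχbar_pos, rfl⟩
    rintro m ⟨χ, -, rfl⟩
    exact integral_nonneg fun h => Finset.sum_nonneg fun i _ => sq_nonneg _
  have hbar : σbar ^ 2 = σz ^ 2 + c * M σbar := hσbar
  have hle : σstar ≤ σbar := by
    by_contra! hlt
    have hprox : ∀ σ : ℝ, 0 < σ → ∀ u, IsSlopeProx lam (σ * χbar) u (η (σ * χbar) u) :=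
      fun σ hσ u => hη _ u (by positivity)
    have hmonoM : M σstar / σstar ^ 2 ≤ M σbar / σbar ^ 2 := by
      simp only [hM, ← integral_div]
      refine integral_mono ?_ ?_ fun h => ?_
      · exact (integrable_slopeProx_error hlam hnonneg (by positivity)
          (hprox σstar hσstar_pos) x σstar).div_const _
      · exact (integrable_slopeProx_error hlam hnonneg (by positivity)
          (hprox σbar hσbar_pos) x σbar).div_const _
      · exact (hprox σbar hσbar_pos _).relative_error_antitone hlam hnonneg hσbar_pos hlt
          hχbar_pos.le (hprox σstar hσstar_pos _)
    have h1 : 1 ≤ σz ^ 2 / σstar ^ 2 + c * (M σstar / σstar ^ 2) := by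
      rw [← mul_div_assoc, ← add_div, one_le_div (by positivity)]
      exact hopt
    have h2 : 1 = σz ^ 2 / σbar ^ 2 + c * (M σbar / σbar ^ 2) := by
      rw [← mul_div_assoc, ← add_div, ← hbar, div_self (by positivity)]
    have h3 : σz ^ 2 / σstar ^ 2 < σz ^ 2 / σbar ^ 2 := by gcongr
    linarith [mul_le_mul_of_nonneg_left hmonoM hc0]
  exact ⟨hle, by gcongr⟩
end
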